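/- Let f_θ be a two-layer ReLU network fit to training data (x_1,y_1),…,(x_n,y_n) with all x_i in the closed ball B_R^d, let g be the data-dependent weight determined by x_1,…,x_n, and suppose the empirical loss L is twice differentiable at θ. Then |f_θ|_{V_g} ≤ λ_max(∇²_θ L(θ))/2 − 1/2 + (R+1)√(2 L(θ)), where λ_max denotes the largest eigenvalue of the Hessian of L with respect to all parameters. -/

import Mathlib

open MeasureTheory Real Filter ProbabilityTheory
open scoped ENNReal Classical BigOperators

noncomputable section

abbrev Euc (d : ℕ) : Type := EuclideanSpace ℝ (Fin d)

def relu (t : ℝ) : ℝ := max t 0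

abbrev ParamIx (d K : ℕ) : Type := (Fin K × Fin d) ⊕ (Fin K ⊕ (Fin K ⊕ Unit))

abbrev Params (d K : ℕ) : Type := EuclideanSpace ℝ (ParamIx d K)

/-- input-layer weight `w_k j` -/
def wP {d K : ℕ} (θ : Params d K) (k : Fin K) (j : Fin d) : ℝ := θ (Sum.inl (k, j))
/-- input-layer bias `b_k` -/
def bP {d K : ℕ} (θ : Params d K) (k : Fin K) : ℝ := θ (Sum.inr (Sum.inl k))
/-- output-layer weight `v_k` -/
def vP {d K : ℕ} (θ : Params d K) (k : Fin K) : ℝ := θ (Sum.inr (Sum.inr (Sum.inl k)))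
/-- output bias `β` -/
def betaP {d K : ℕ} (θ : Params d K) : ℝ := θ (Sum.inr (Sum.inr (Sum.inr ())))

/-- two-layer ReLU network `f_θ(x) = Σ_k v_k relu(w_kᵀ x − b_k) + β` -/
def netFun {d K : ℕ} (θ : Params d K) (x : Euc d) : ℝ :=
  (∑ k, vP θ k * relu ((∑ j, wP θ k j * x j) - bP θ k)) + betaP θ

/-- empirical squared loss -/
def empLoss {d K : ℕ} (n : ℕ) (x : Fin n → Euc d) (y : Fin n → ℝ) (θ : Params d K) : ℝ :=
  (1 / (2 * (n : ℝ))) * ∑ i, (y i - netFun θ (x i)) ^ 2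

/-- Hessian quadratic form `vᵀ ∇²L(θ) v` -/
def hessQF {E : Type*} [NormedAddCommGroup E] [NormedSpace ℝ E] (L : E → ℝ) (θ v : E) : ℝ :=
  iteratedFDeriv ℝ 2 L θ ![v, v]

/-- largest eigenvalue of the (symmetric) Hessian of `L` at `θ` -/
def lambdaMax {E : Type*} [NormedAddCommGroup E] [NormedSpace ℝ E] (L : E → ℝ) (θ : E) : ℝ :=
  ⨆ v : {v : E // ‖v‖ = 1}, hessQF L θ v.1

/-- weighted variation seminorm -/
def VgSeminorm (d : ℕ) (R : ℝ) (g : Euc d × ℝ → ℝ) (f : Euc d → ℝ) : ℝ≥0∞ :=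
  sInf { m : ℝ≥0∞ |
    ∃ (ν : MeasureTheory.SignedMeasure (Euc d × ℝ)) (c : Euc d) (c₀ : ℝ),
      ν.totalVariation ((Metric.sphere (0 : Euc d) 1 ×ˢ Set.Icc (-R) R)ᶜ) = 0 ∧
      (∀ x ∈ Metric.closedBall (0 : Euc d) R,
        f x = (∫ p : Euc d × ℝ, relu ((∑ j, p.1 j * x j) - p.2)
                  ∂ν.toJordanDecomposition.posPart)
              - (∫ p : Euc d × ℝ, relu ((∑ j, p.1 j * x j) - p.2)
                  ∂ν.toJordanDecomposition.negPart)
              + (∑ j, c j * x j) + c₀) ∧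
      m = ∫⁻ p, ENNReal.ofReal (g p) ∂ν.totalVariation }

def gTilde {d : ℕ} (n : ℕ) (x : Fin n → Euc d) (u : Euc d) (t : ℝ) : ℝ :=
  (((Finset.univ.filter fun i => t < ∑ j, u j * x i j).card : ℝ) / (n : ℝ)) ^ 2 *
    ((∑ i ∈ Finset.univ.filter fun i => t < ∑ j, u j * x i j, ((∑ j, u j * x i j) - t)) /
      ((Finset.univ.filter fun i => t < ∑ j, u j * x i j).card : ℝ)) *
    Real.sqrt (1 + ‖(((Finset.univ.filter fun i => t < ∑ j, u j * x i j).card : ℝ))⁻¹ •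
      ∑ i ∈ Finset.univ.filter fun i => t < ∑ j, u j * x i j, x i‖ ^ 2)

def gData {d : ℕ} (n : ℕ) (x : Fin n → Euc d) : Euc d × ℝ → ℝ :=
  fun p => min (gTilde n x p.1 p.2) (gTilde n x (-p.1) (-p.2))

def gPow (d : ℕ) : Euc d × ℝ → ℝ :=
  fun p => if |p.2| ≤ 1 then (1 - |p.2|) ^ (d + 2) else 0

def uniformBall (d : ℕ) : Measure (Euc d) :=
  (volume (Metric.closedBall (0 : Euc d) 1))⁻¹ • volume.restrict (Metric.closedBall 0 1)

instance (d : ℕ) : IsProbabilityMeasure (uniformBall d) := by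
  constructor
  rw [uniformBall, Measure.smul_apply, Measure.restrict_apply MeasurableSet.univ,
    Set.univ_inter, smul_eq_mul, ENNReal.inv_mul_cancel]
  · exact (Metric.measure_closedBall_pos volume (0 : Euc d) one_pos).ne'
  · exact (isCompact_closedBall _ _).measure_lt_top.ne

/-- set of stable solutions for the dataset `(x, y)` -/
def FStable (d : ℕ) (η : ℝ) {n : ℕ} (x : Fin n → Euc d) (y : Fin n → ℝ) (f : Euc d → ℝ) : Prop :=
  ∃ (K : ℕ) (θ : Params d K),
    (∀ z, f z = netFun θ z) ∧
    ContDiffAt ℝ 2 (empLoss n x y) θ ∧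
    lambdaMax (empLoss n x y) θ ≤ 2 / η

/-- membership in the (unweighted) variation ball `V_C(B_1^d)` -/
def memVC (d : ℕ) (C : ℝ) (f : Euc d → ℝ) : Prop :=
  ∃ (ν : MeasureTheory.SignedMeasure (Euc d × ℝ)) (c : Euc d) (b : ℝ),
    ν.totalVariation ((Metric.sphere (0 : Euc d) 1 ×ˢ Set.Icc (-1 : ℝ) 1)ᶜ) = 0 ∧
    ν.totalVariation Set.univ ≤ ENNReal.ofReal C ∧
    ∀ x ∈ Metric.closedBall (0 : Euc d) 1,
      f x = (∫ p : Euc d × ℝ, relu ((∑ j, p.1 j * x j) - p.2)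
                ∂ν.toJordanDecomposition.posPart)
            - (∫ p : Euc d × ℝ, relu ((∑ j, p.1 j * x j) - p.2)
                ∂ν.toJordanDecomposition.negPart)
            + (∑ j, c j * x j) + b



lemma jordan_facts {α : Type*} [MeasurableSpace α] (μ₁ μ₂ : Measure α) [IsFiniteMeasure μ₁]
    [IsFiniteMeasure μ₂] (ν : SignedMeasure α) (hν : ν = μ₁.toSignedMeasure - μ₂.toSignedMeasure) :
    ν.toJordanDecomposition.posPart ≤ μ₁ ∧ ν.toJordanDecomposition.negPart ≤ μ₂ ∧
    ν.toJordanDecomposition.posPart + μ₂ = ν.toJordanDecomposition.negPart + μ₁ := by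
  obtain ⟨P, hP, hP1, hP2, hp, hq⟩ := ν.toJordanDecomposition_spec
  refine ⟨?_, ?_, ?_⟩
  · refine Measure.le_iff.2 fun s hs => ?_
    rw [← ENNReal.toReal_le_toReal (measure_ne_top _ _) (measure_ne_top _ _)]
    change (ν.toJordanDecomposition.posPart).real s ≤ μ₁.real s
    rw [hp, SignedMeasure.toMeasureOfZeroLE_real_apply _ hP1 hP hs, hν,
      Measure.toSignedMeasure_sub_apply (hP.inter hs)]
    have h1 : μ₁.real (P ∩ s) ≤ μ₁.real s := measureReal_mono Set.inter_subset_right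
    have h2 : 0 ≤ μ₂.real (P ∩ s) := measureReal_nonneg
    linarith
  · refine Measure.le_iff.2 fun s hs => ?_
    rw [← ENNReal.toReal_le_toReal (measure_ne_top _ _) (measure_ne_top _ _)]
    change (ν.toJordanDecomposition.negPart).real s ≤ μ₂.real s
    rw [hq, SignedMeasure.toMeasureOfLEZero_real_apply _ hP2 hP.compl hs, hν,
      Measure.toSignedMeasure_sub_apply (hP.compl.inter hs)]
    have h1 : μ₂.real (Pᶜ ∩ s) ≤ μ₂.real s := measureReal_mono Set.inter_subset_right
    have h2 : 0 ≤ μ₁.real (Pᶜ ∩ s) := measureReal_nonneg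
    linarith
  · rw [← Measure.toSignedMeasure_eq_toSignedMeasure_iff, Measure.toSignedMeasure_add,
      Measure.toSignedMeasure_add]
    have := ν.toSignedMeasure_toJordanDecomposition
    rw [JordanDecomposition.toSignedMeasure] at this
    have h3 : ν.toJordanDecomposition.posPart.toSignedMeasure -
      ν.toJordanDecomposition.negPart.toSignedMeasure =
      μ₁.toSignedMeasure - μ₂.toSignedMeasure := this.trans hν
    rw [sub_eq_sub_iff_add_eq_add] at h3
    rw [h3, add_comm]

/-- the atomic measure -/
def atomic {α ι : Type*} [MeasurableSpace α] (S : Finset ι) (a : ι → ℝ) (p : ι → α) : Measure α :=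
  ∑ k ∈ S, ENNReal.ofReal (a k) • Measure.dirac (p k)

instance {α ι : Type*} [MeasurableSpace α] (S : Finset ι) (a : ι → ℝ) (p : ι → α) :
    IsFiniteMeasure (atomic S a p) := by
  constructor
  simp [atomic]

lemma atomic_lintegral {α ι : Type*} [MeasurableSpace α] [MeasurableSingletonClass α]
    (S : Finset ι) (a : ι → ℝ) (p : ι → α) (h : α → ℝ≥0∞) :
    ∫⁻ z, h z ∂(atomic S a p) = ∑ k ∈ S, ENNReal.ofReal (a k) * h (p k) := by
  simp [atomic]

lemma atomic_integrable {α ι : Type*} [MeasurableSpace α] [MeasurableSingletonClass α]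
    (S : Finset ι) (a : ι → ℝ) (p : ι → α) (h : α → ℝ) :
    Integrable h (atomic S a p) := by
  rw [atomic, integrable_finsetSum_measure]
  intro k _
  exact (integrable_dirac (by simp)).smul_measure (by simp)

lemma atomic_integral {α ι : Type*} [MeasurableSpace α] [MeasurableSingletonClass α]
    (S : Finset ι) (a : ι → ℝ) (p : ι → α) (h : α → ℝ) :
    ∫ z, h z ∂(atomic S a p) = ∑ k ∈ S, max (a k) 0 * h (p k) := by
  rw [atomic, integral_finsetSum_measure]
  · refine Finset.sum_congr rfl fun k _ => ?_
    rw [integral_smul_measure, integral_dirac, ENNReal.toReal_ofReal', smul_eq_mul]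
  · intro k _
    exact (integrable_dirac (by simp)).smul_measure (by simp)

lemma atomic_signed {α ι : Type*} [MeasurableSpace α] [MeasurableSingletonClass α]
    (S : Finset ι) (a : ι → ℝ) (p : ι → α) :
    ∃ ν : SignedMeasure α,
      (∀ B : Set α, MeasurableSet B → (∀ k ∈ S, p k ∈ B) → ν.totalVariation Bᶜ = 0) ∧
      (∀ h : α → ℝ, ∫ z, h z ∂ν.toJordanDecomposition.posPart
        - ∫ z, h z ∂ν.toJordanDecomposition.negPart = ∑ k ∈ S, a k * h (p k)) ∧
      (∀ g : α → ℝ, (∫⁻ z, ENNReal.ofReal (g z) ∂ν.totalVariation) ≤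
        ∑ k ∈ S, ENNReal.ofReal (|a k| * g (p k))) := by
  obtain ⟨h1, h2, h3⟩ := jordan_facts (atomic S a p) (atomic S (fun k => - a k) p) _ rfl
  set ν := (atomic S a p).toSignedMeasure - (atomic S (fun k => - a k) p).toSignedMeasure
  have htv : ν.totalVariation ≤ atomic S a p + atomic S (fun k => - a k) p := by
    rw [SignedMeasure.totalVariation]; exact add_le_add h1 h2
  refine ⟨ν, ?_, ?_, ?_⟩
  · intro B hB hp
    refine le_antisymm ((htv _).trans ?_) (by simp)
    rw [Measure.add_apply, atomic, atomic, Measure.finsetSum_apply, Measure.finsetSum_apply,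
      Finset.sum_eq_zero, Finset.sum_eq_zero, add_zero]
    · intro k hk
      simp [hB.compl, hp k hk]
    · intro k hk
      simp [hB.compl, hp k hk]
  · intro h
    have i1 := (atomic_integrable S a p h)
    have i2 := (atomic_integrable S (fun k => - a k) p h)
    have := congrArg (fun μ => ∫ z, h z ∂μ) h3
    beta_reduce at this
    rw [integral_add_measure (i1.mono_measure h1) i2, integral_add_measure (i2.mono_measure h2) i1,
      atomic_integral, atomic_integral] at this
    have h4 : ∑ k ∈ S, a k * h (p k) = ∑ k ∈ S, max (a k) 0 * h (p k)
        - ∑ k ∈ S, max (- a k) 0 * h (p k) := by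
      rw [← Finset.sum_sub_distrib]
      refine Finset.sum_congr rfl fun k _ => ?_
      rw [← sub_mul]
      congr 1
      rcases le_total 0 (a k) with h | h <;> simp [h]
    linarith
  · intro g
    refine (lintegral_mono' htv le_rfl).trans ?_
    rw [lintegral_add_measure, atomic_lintegral, atomic_lintegral, ← Finset.sum_add_distrib]
    refine Finset.sum_le_sum fun k _ => ?_
    rw [← add_mul, ENNReal.ofReal_mul (abs_nonneg _)]
    gcongr
    rcases le_total 0 (a k) with h | h <;> simp [h, abs_of_nonneg, abs_of_nonpos, ENNReal.ofReal_of_nonpos]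

lemma hess_line {E : Type*} [NormedAddCommGroup E] [NormedSpace ℝ E] (L : E → ℝ)
    (hL : ContDiff ℝ 2 L) (θ u : E) (c0 c1 c2 c3 c4 : ℝ)
    (h : ∀ s : ℝ, L (θ + s • u) = c0 + c1 * s + c2 * s ^ 2 + c3 * s ^ 3 + c4 * s ^ 4) :
    hessQF L θ u = 2 * c2 := by
  have hline : ∀ s : ℝ, HasDerivAt (fun s : ℝ => θ + s • u) u s := fun s => by
    simpa using ((hasDerivAt_id s).smul_const u).const_add θ
  have hd : Differentiable ℝ L := hL.differentiable (by norm_num)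
  have h1 : ∀ s : ℝ, fderiv ℝ L (θ + s • u) u = c1 + c2 * (2 * s) + c3 * (3 * s ^ 2) + c4 * (4 * s ^ 3) := by
    intro s
    have e1 : HasDerivAt (fun s : ℝ => L (θ + s • u)) (fderiv ℝ L (θ + s • u) u) s :=
      (hd _).hasFDerivAt.comp_hasDerivAt s (hline s)
    have e2 : HasDerivAt (fun s : ℝ => L (θ + s • u))
        (c1 + c2 * (2 * s) + c3 * (3 * s ^ 2) + c4 * (4 * s ^ 3)) s := by
      rw [funext h]
      have := ((((hasDerivAt_const s c0).add ((hasDerivAt_id s).const_mul c1)).add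
        ((hasDerivAt_pow 2 s).const_mul c2)).add ((hasDerivAt_pow 3 s).const_mul c3)).add
        ((hasDerivAt_pow 4 s).const_mul c4)
      refine HasDerivAt.congr_deriv this ?_
      simp only [zero_add, mul_one, Nat.cast_ofNat, Nat.add_one_sub_one, pow_one]
    exact e1.unique e2
  have hd2 : Differentiable ℝ (fderiv ℝ L) :=
    (hL.fderiv_right (m := 1) (by norm_num)).differentiable (by norm_num)
  have e1 : HasDerivAt (fun s : ℝ => fderiv ℝ L (θ + s • u)) (fderiv ℝ (fderiv ℝ L) (θ + (0:ℝ) • u) u) 0 :=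
      (hd2 _).hasFDerivAt.comp_hasDerivAt 0 (hline 0)
  have e2 : HasDerivAt (fun s : ℝ => fderiv ℝ L (θ + s • u) u)
      (fderiv ℝ (fderiv ℝ L) (θ + (0:ℝ) • u) u u) 0 := by
    simpa using e1.clm_apply (hasDerivAt_const 0 u)
  have e3 : HasDerivAt (fun s : ℝ => fderiv ℝ L (θ + s • u) u) (2 * c2) 0 := by
    rw [funext h1]
    have := ((((hasDerivAt_const (0:ℝ) c1).add (((hasDerivAt_id (0:ℝ)).const_mul 2).const_mul c2))).add
        (((hasDerivAt_pow 2 (0:ℝ)).const_mul 3).const_mul c3)).add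
        (((hasDerivAt_pow 3 (0:ℝ)).const_mul 4).const_mul c4)
    refine HasDerivAt.congr_deriv this ?_
    simp [mul_comm]
  have := e2.unique e3
  rw [hessQF, iteratedFDeriv_two_apply]
  simpa using this

lemma hess_le_lambdaMax {E : Type*} [NormedAddCommGroup E] [NormedSpace ℝ E] (L : E → ℝ)
    (θ u : E) (hu : ‖u‖ = 1) : hessQF L θ u ≤ lambdaMax L θ := by
  refine le_ciSup (f := fun v : {v : E // ‖v‖ = 1} => hessQF L θ v.1) ?_ ⟨u, hu⟩
  refine ⟨‖iteratedFDeriv ℝ 2 L θ‖, ?_⟩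
  rintro _ ⟨v, rfl⟩
  have := (iteratedFDeriv ℝ 2 L θ).le_opNorm ![v.1, v.1]
  simp only [Fin.prod_univ_two, Matrix.cons_val_zero, Matrix.cons_val_one, v.2, mul_one] at this
  exact (le_abs_self _).trans this

/-- pre-activation -/
def preA {d K : ℕ} (x : Euc d) (θ : Params d K) (k : Fin K) : ℝ :=
  (∑ j, wP θ k j * x j) - bP θ k

/-- activation-pattern-frozen network -/
def frozenNet {d K : ℕ} (a : Fin K → ℝ) (x : Euc d) (θ : Params d K) : ℝ :=
  (∑ k, vP θ k * (a k * preA x θ k)) + betaP θ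

def frozenLoss {d K : ℕ} (n : ℕ) (a : Fin n → Fin K → ℝ) (x : Fin n → Euc d) (y : Fin n → ℝ)
    (θ : Params d K) : ℝ :=
  (1 / (2 * (n : ℝ))) * ∑ i, (y i - frozenNet (a i) (x i) θ) ^ 2

lemma preA_contDiff {d K : ℕ} (x : Euc d) (k : Fin K) :
    ContDiff ℝ 2 (fun θ : Params d K => preA x θ k) := by
  unfold preA wP bP
  fun_prop

lemma frozenLoss_contDiff {d K : ℕ} (n : ℕ) (a : Fin n → Fin K → ℝ) (x : Fin n → Euc d)
    (y : Fin n → ℝ) : ContDiff ℝ 2 (frozenLoss (d := d) n a x y) := by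
  unfold frozenLoss frozenNet preA wP bP vP betaP
  fun_prop

/-- strict activation indicator -/
def act {d K : ℕ} (x : Euc d) (θ : Params d K) (k : Fin K) : ℝ :=
  if 0 < preA x θ k then 1 else 0

lemma relu_act {d K : ℕ} (x : Euc d) (θ : Params d K) (k : Fin K) :
    relu (preA x θ k) = act x θ k * preA x θ k := by
  unfold relu act
  split_ifs with h
  · simp [h.le]
  · simp [not_lt.1 h]

lemma netFun_eq {d K : ℕ} (x : Euc d) (θ : Params d K) :
    netFun θ x = frozenNet (act x θ) x θ := by
  unfold frozenNet
  simp only [← relu_act]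
  rfl

lemma hess_eq {d K : ℕ} (n : ℕ) (x : Fin n → Euc d) (y : Fin n → ℝ) (θ u : Params d K)
    (hdiff : ContDiffAt ℝ 2 (empLoss n x y) θ) :
    hessQF (empLoss n x y) θ u =
      hessQF (frozenLoss n (fun i => act (x i) θ) x y) θ u := by
  set Lt := frozenLoss (d := d) n (fun i => act (x i) θ) x y with hLt
  let e : Params d K := WithLp.toLp 2 (Sum.elim 0 (Sum.elim 1 0))
  have hpre : ∀ i k (s : ℝ), preA (x i) (θ + s • e) k = preA (x i) θ k - s := by
    intro i k s
    simp [preA, wP, bP, e]; ring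
  have key : ∀ᶠ s : ℝ in nhdsWithin 0 (Set.Ioi 0),
      iteratedFDeriv ℝ 2 (empLoss n x y) (θ + s • e) = iteratedFDeriv ℝ 2 Lt (θ + s • e) := by
    have h1 : ∀ᶠ s : ℝ in nhdsWithin 0 (Set.Ioi 0), ∀ i k,
        0 < preA (x i) θ k → s < preA (x i) θ k := by
      rw [eventually_all]; intro i
      rw [eventually_all]; intro k
      by_cases h : 0 < preA (x i) θ k
      · filter_upwards [mem_nhdsWithin_of_mem_nhds (Iio_mem_nhds h)] with s hs _ using hs
      · exact Eventually.of_forall fun s h' => absurd h' h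
    filter_upwards [h1, self_mem_nhdsWithin] with s hs hs0
    have hs0 : 0 < s := hs0
    apply Filter.EventuallyEq.eq_of_nhds
    apply Filter.EventuallyEq.iteratedFDeriv
    have h2 : ∀ᶠ θ' in nhds (θ + s • e), ∀ i k, act (x i) θ' k = act (x i) θ k := by
      rw [eventually_all]; intro i
      rw [eventually_all]; intro k
      have hc := (preA_contDiff (d := d) (x i) k).continuous.continuousAt (x := θ + s • e)
      by_cases h : 0 < preA (x i) θ k
      · have : 0 < preA (x i) (θ + s • e) k := by
          rw [hpre]; linarith [hs i k h]
        filter_upwards [hc.eventually (lt_mem_nhds this)] with θ' h'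
        simp [act, h, h']
      · have : preA (x i) (θ + s • e) k < 0 := by
          rw [hpre]; linarith
        filter_upwards [hc.eventually (gt_mem_nhds this)] with θ' h'
        simp [act, h, h'.le]
    filter_upwards [h2] with θ' h'
    rw [hLt, empLoss, frozenLoss]
    congr 1
    refine Finset.sum_congr rfl fun i _ => ?_
    rw [netFun_eq, show act (x i) θ' = act (x i) θ from funext (h' i)]
  have ht : Tendsto (fun s : ℝ => θ + s • e) (nhdsWithin 0 (Set.Ioi 0)) (nhds θ) := by
    have : Continuous (fun s : ℝ => θ + s • e) := by fun_prop
    have h := this.tendsto 0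
    simp only [zero_smul, add_zero] at h
    exact h.mono_left nhdsWithin_le_nhds
  have t1 := (hdiff.continuousAt_iteratedFDeriv (k := 2) (by norm_num)).tendsto.comp ht
  have t2 := ((frozenLoss_contDiff n (fun i => act (x i) θ) x y).contDiffAt (x := θ)
    |>.continuousAt_iteratedFDeriv (k := 2) (by norm_num)).tendsto.comp ht
  have := tendsto_nhds_unique_of_eventuallyEq t1 t2 key
  rw [hessQF, hessQF, this]


lemma preA_line {d K : ℕ} (x : Euc d) (θ u : Params d K) (s : ℝ) (k : Fin K) :
    preA x (θ + s • u) k = preA x θ k + s * preA x u k := by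
  simp only [preA, wP, bP, PiLp.add_apply, PiLp.smul_apply, smul_eq_mul, add_mul,
    Finset.sum_add_distrib, mul_sub, Finset.mul_sum, mul_assoc]
  ring

/-- first-order coefficient -/
def pC {d K : ℕ} (a : Fin K → ℝ) (x : Euc d) (θ u : Params d K) : ℝ :=
  (∑ k, a k * (vP u k * preA x θ k + vP θ k * preA x u k)) + betaP u

/-- second-order coefficient -/
def qC {d K : ℕ} (a : Fin K → ℝ) (x : Euc d) (u : Params d K) : ℝ :=
  ∑ k, a k * (vP u k * preA x u k)

lemma frozenNet_line {d K : ℕ} (a : Fin K → ℝ) (x : Euc d) (θ u : Params d K) (s : ℝ) :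
    frozenNet a x (θ + s • u) = frozenNet a x θ + s * pC a x θ u + s ^ 2 * qC a x u := by
  have h1 : ∀ k, vP (θ + s • u) k = vP θ k + s * vP u k := fun k => by simp [vP]
  have h2 : betaP (θ + s • u) = betaP θ + s * betaP u := by simp [betaP]
  simp only [frozenNet, pC, qC, h1, h2, preA_line, mul_add, Finset.mul_sum]
  have : ∀ k, (vP θ k + s * vP u k) * (a k * preA x θ k) +
      (vP θ k + s * vP u k) * (a k * (s * preA x u k)) =
      vP θ k * (a k * preA x θ k) + (s * (a k * (vP u k * preA x θ k)) +
       s * (a k * (vP θ k * preA x u k))) + s ^ 2 * (a k * (vP u k * preA x u k)) := by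
    intro k; ring
  simp only [this, Finset.sum_add_distrib]
  ring

lemma frozen_hess {d K : ℕ} (n : ℕ) (a : Fin n → Fin K → ℝ) (x : Fin n → Euc d) (y : Fin n → ℝ)
    (θ u : Params d K) : hessQF (frozenLoss n a x y) θ u =
      (1 / (n : ℝ)) * ∑ i, (pC (a i) (x i) θ u ^ 2 -
        2 * (y i - frozenNet (a i) (x i) θ) * qC (a i) (x i) u) := by
  rw [hess_line _ (frozenLoss_contDiff n a x y) θ u
    ((1 / (2 * (n : ℝ))) * ∑ i, (y i - frozenNet (a i) (x i) θ) ^ 2)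
    ((1 / (2 * (n : ℝ))) * ∑ i, (-2 * (y i - frozenNet (a i) (x i) θ) * pC (a i) (x i) θ u))
    ((1 / (2 * (n : ℝ))) * ∑ i, (pC (a i) (x i) θ u ^ 2 -
        2 * (y i - frozenNet (a i) (x i) θ) * qC (a i) (x i) u))
    ((1 / (2 * (n : ℝ))) * ∑ i, (2 * pC (a i) (x i) θ u * qC (a i) (x i) u))
    ((1 / (2 * (n : ℝ))) * ∑ i, (qC (a i) (x i) u) ^ 2)]
  · rw [one_div, one_div, mul_inv]; ring
  · intro s
    simp only [frozenLoss, frozenNet_line]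
    rw [mul_assoc, mul_assoc, mul_assoc, mul_assoc, ← mul_add, ← mul_add, ← mul_add, ← mul_add]
    congr 1
    simp only [Finset.sum_mul, ← Finset.sum_add_distrib]
    refine Finset.sum_congr rfl fun i _ => ?_
    ring

lemma norm_sq_params {d K : ℕ} (u : Params d K) :
    ‖u‖ ^ 2 = (∑ k, ((∑ j, wP u k j ^ 2) + bP u k ^ 2 + vP u k ^ 2)) + betaP u ^ 2 := by
  rw [EuclideanSpace.real_norm_sq_eq]
  simp only [Fintype.sum_sum_type, Fintype.sum_prod_type, Finset.sum_add_distrib, wP, bP, vP, betaP,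
    Finset.univ_unique, Finset.sum_singleton]
  simp only [add_assoc]

lemma abs_dot_le {d : ℕ} (w : Fin d → ℝ) (x : Euc d) (R : ℝ) (hx : ‖x‖ ≤ R) :
    |∑ j, w j * x j| ≤ R * ‖(WithLp.toLp 2 w : Euc d)‖ := by
  have h := abs_real_inner_le_norm x (WithLp.toLp 2 w : Euc d)
  have e : inner ℝ x (WithLp.toLp 2 w : Euc d) = ∑ j, w j * x j := by
    simp [PiLp.inner_apply]
  rw [e] at h
  exact h.trans (by gcongr)

lemma qC_le {d K : ℕ} (a : Fin K → ℝ) (ha : ∀ k, a k = 0 ∨ a k = 1) (x : Euc d) (u : Params d K)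
    (R : ℝ) (hR : 0 < R) (hx : ‖x‖ ≤ R) (hu : ‖u‖ = 1) : 2 * |qC a x u| ≤ R + 1 := by
  have h1 : ∀ k, 2 * |a k * (vP u k * preA x u k)| ≤
      (R + 1) * ((∑ j, wP u k j ^ 2) + bP u k ^ 2 + vP u k ^ 2) := by
    intro k
    have hW := abs_dot_le (wP u k) x R hx
    set N := ‖(WithLp.toLp 2 (wP u k) : Euc d)‖ with hN
    have hN2 : N ^ 2 = ∑ j, wP u k j ^ 2 := by
      rw [hN, EuclideanSpace.real_norm_sq_eq]
    have hN0 : 0 ≤ N := norm_nonneg _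
    rw [← hN2]
    have h2 : |a k * (vP u k * preA x u k)| ≤ |vP u k| * (R * N + |bP u k|) := by
      rw [abs_mul, abs_mul]
      have h3 : |preA x u k| ≤ R * N + |bP u k| := by
        unfold preA
        exact (abs_sub _ _).trans (by gcongr)
      have h4 : |a k| ≤ 1 := by rcases ha k with h | h <;> simp [h]
      have h5 : |vP u k| * |preA x u k| ≤ |vP u k| * (R * N + |bP u k|) := by gcongr
      have h6 : 0 ≤ |vP u k| * |preA x u k| := by positivity
      nlinarith [abs_nonneg (a k)]
    have h7 := sq_abs (vP u k)
    have h8 := sq_abs (bP u k)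
    have h9 := mul_nonneg hR.le (sq_nonneg (|vP u k| - N))
    rw [← h7, ← h8]
    nlinarith [sq_nonneg (|vP u k| - |bP u k|), mul_nonneg hR.le (sq_nonneg (|bP u k|)), sq_nonneg N]
  have h2 := norm_sq_params u
  rw [hu] at h2
  calc 2 * |qC a x u| ≤ 2 * ∑ k, |a k * (vP u k * preA x u k)| := by
        gcongr; exact Finset.abs_sum_le_sum_abs _ _
    _ = ∑ k, 2 * |a k * (vP u k * preA x u k)| := by rw [Finset.mul_sum]
    _ ≤ ∑ k, (R + 1) * ((∑ j, wP u k j ^ 2) + bP u k ^ 2 + vP u k ^ 2) :=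
        Finset.sum_le_sum fun k _ => h1 k
    _ = (R + 1) * ∑ k, ((∑ j, wP u k j ^ 2) + bP u k ^ 2 + vP u k ^ 2) := by rw [Finset.mul_sum]
    _ ≤ R + 1 := by nlinarith [sq_nonneg (betaP u)]

/-- mean gradient -/
def gradM {d K : ℕ} (n : ℕ) (a : Fin n → Fin K → ℝ) (x : Fin n → Euc d) (θ : Params d K) :
    Params d K :=
  WithLp.toLp 2 (Sum.elim (fun kj => vP θ kj.1 * ((n : ℝ)⁻¹ * ∑ i, a i kj.1 * x i kj.2))
    (Sum.elim (fun k => - (vP θ k * ((n : ℝ)⁻¹ * ∑ i, a i k)))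
      (Sum.elim (fun k => (n : ℝ)⁻¹ * ∑ i, a i k * preA (x i) θ k) (fun _ => 1))))

lemma mean_pC {d K : ℕ} (n : ℕ) (hn : 0 < n) (a : Fin n → Fin K → ℝ) (x : Fin n → Euc d)
    (θ u : Params d K) :
    (n : ℝ)⁻¹ * ∑ i, pC (a i) (x i) θ u = (∑ k, ((∑ j, wP (gradM n a x θ) k j * wP u k j)
      + bP (gradM n a x θ) k * bP u k + vP (gradM n a x θ) k * vP u k)) + betaP u := by
  have hn' : (n : ℝ) ≠ 0 := by positivity
  simp only [pC, Finset.sum_add_distrib, mul_add, Finset.sum_const, Finset.card_univ,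
    Fintype.card_fin, nsmul_eq_mul]
  rw [inv_mul_cancel_left₀ hn']
  congr 1
  rw [← mul_add, ← Finset.sum_add_distrib]
  simp only [← Finset.sum_add_distrib]
  rw [Finset.sum_comm, Finset.mul_sum]
  refine Finset.sum_congr rfl fun k _ => ?_
  simp only [gradM, wP, bP, vP, Sum.elim_inl, Sum.elim_inr]
  have e : ∀ i, a i k * (u (Sum.inr (Sum.inr (Sum.inl k))) * preA (x i) θ k) +
      a i k * (θ (Sum.inr (Sum.inr (Sum.inl k))) * preA (x i) u k) =
      ∑ j, (θ (Sum.inr (Sum.inr (Sum.inl k))) * (a i k * x i j) * u (Sum.inl (k, j)))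
      + (-(θ (Sum.inr (Sum.inr (Sum.inl k))) * a i k) * u (Sum.inr (Sum.inl k)))
      + a i k * preA (x i) θ k * u (Sum.inr (Sum.inr (Sum.inl k))) := by
    intro i
    have : preA (x i) u k = (∑ j, u (Sum.inl (k, j)) * x i j) - u (Sum.inr (Sum.inl k)) := rfl
    rw [this, mul_sub, mul_sub, Finset.mul_sum, Finset.mul_sum]
    have : ∀ j, a i k * (θ (Sum.inr (Sum.inr (Sum.inl k))) * (u (Sum.inl (k, j)) * x i j)) =
      (θ (Sum.inr (Sum.inr (Sum.inl k))) * (a i k * x i j) * u (Sum.inl (k, j))) := by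
      intro j; ring
    simp only [this]
    ring
  simp only [e, Finset.sum_add_distrib]
  rw [Finset.sum_comm]
  simp only [← Finset.sum_mul, ← Finset.mul_sum, Finset.sum_neg_distrib]
  rw [mul_add, mul_add, Finset.mul_sum]
  congr 1
  · congr 1
    · refine Finset.sum_congr rfl fun j _ => ?_
      ring
    · ring
  · ring

/-- homogeneous weight of a neuron -/
def cW {d K : ℕ} (n : ℕ) (x : Fin n → Euc d) (θ : Params d K) (k : Fin K) : ℝ :=
  |vP θ k| * ((n : ℝ)⁻¹ * ∑ i, act (x i) θ k * preA (x i) θ k) *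
    Real.sqrt (((n : ℝ)⁻¹ * ∑ i, act (x i) θ k) ^ 2 +
      ‖(n : ℝ)⁻¹ • ∑ i, act (x i) θ k • x i‖ ^ 2)

lemma grad_norm {d K : ℕ} (n : ℕ) (x : Fin n → Euc d) (θ : Params d K) :
    1 + 2 * ∑ k, cW n x θ k ≤ ‖gradM n (fun i => act (x i) θ) x θ‖ ^ 2 := by
  rw [norm_sq_params, add_comm, Finset.mul_sum]
  have : betaP (gradM n (fun i => act (x i) θ) x θ) = 1 := rfl
  rw [this, one_pow]
  gcongr with k _
  simp only [gradM, wP, bP, vP, Sum.elim_inl, Sum.elim_inr]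
  unfold cW vP
  set A := (n : ℝ)⁻¹ * ∑ i, act (x i) θ k * preA (x i) θ k
  set P := (n : ℝ)⁻¹ * ∑ i, act (x i) θ k
  set v := θ (Sum.inr (Sum.inr (Sum.inl k)))
  have hX : ‖(n : ℝ)⁻¹ • ∑ i, act (x i) θ k • x i‖ ^ 2 =
      ∑ j, ((n : ℝ)⁻¹ * ∑ i, act (x i) θ k * x i j) ^ 2 := by
    rw [EuclideanSpace.real_norm_sq_eq]
    refine Finset.sum_congr rfl fun j _ => ?_
    simp
  simp only [mul_pow v, ← Finset.mul_sum]
  rw [← hX]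
  set X := ‖(n : ℝ)⁻¹ • ∑ i, act (x i) θ k • x i‖ ^ 2
  have hX0 : 0 ≤ X := by positivity
  have hs := Real.sq_sqrt (show 0 ≤ P ^ 2 + X by positivity)
  have hv := sq_abs v
  rw [neg_sq, mul_pow v P, ← hv]
  have : |v| ^ 2 * X + |v| ^ 2 * P ^ 2 = (|v| * √(P ^ 2 + X)) ^ 2 := by
    rw [mul_pow |v|, hs]; ring
  rw [this]
  nlinarith [sq_nonneg (|v| * √(P ^ 2 + X) - A)]

lemma hess_main {d K n : ℕ} (R : ℝ) (hR : 0 < R) (hn : 0 < n)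
    (x : Fin n → Euc d) (y : Fin n → ℝ) (hx : ∀ i, ‖x i‖ ≤ R)
    (θ : Params d K) (hdiff : ContDiffAt ℝ 2 (empLoss n x y) θ) :
    1 + 2 * ∑ k, cW n x θ k - (R + 1) * √(2 * empLoss n x y θ) ≤
      lambdaMax (empLoss n x y) θ := by
  set a : Fin n → Fin K → ℝ := fun i => act (x i) θ with ha
  set G := gradM n a x θ with hG
  have hG1 := grad_norm n x θ
  have hn' : (0 : ℝ) < n := by positivity
  have hGpos : 0 < ‖G‖ := by
    have h1 : ‖G‖ ^ 2 = _ := norm_sq_params G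
    have h2 : betaP G = 1 := rfl
    rw [h2] at h1
    have : 0 ≤ ∑ k, ((∑ j, wP G k j ^ 2) + bP G k ^ 2 + vP G k ^ 2) := by positivity
    have h0 := norm_nonneg G
    by_contra h
    have : ‖G‖ = 0 := by linarith
    rw [this] at h1
    linarith
  set u := ‖G‖⁻¹ • G with hu
  have hu1 : ‖u‖ = 1 := by
    rw [hu, norm_smul, norm_inv, norm_norm, inv_mul_cancel₀ hGpos.ne']
  refine le_trans ?_ (hess_le_lambdaMax _ θ u hu1)
  rw [hess_eq n x y θ u hdiff, frozen_hess]
  have hmean : (n : ℝ)⁻¹ * ∑ i, pC (a i) (x i) θ u = ‖G‖ := by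
    rw [mean_pC n hn]
    have e1 : ∀ k j, wP u k j = ‖G‖⁻¹ * wP G k j := fun k j => by simp [wP, hu]
    have e2 : ∀ k, bP u k = ‖G‖⁻¹ * bP G k := fun k => by simp [bP, hu]
    have e3 : ∀ k, vP u k = ‖G‖⁻¹ * vP G k := fun k => by simp [vP, hu]
    have e4 : betaP u = ‖G‖⁻¹ * betaP G ^ 2 := by
      have h2 : betaP G = 1 := rfl
      rw [h2]; simp [betaP, hu]; simp only [betaP] at h2; rw [h2, mul_one]
    have : ‖G‖⁻¹ * ‖G‖ ^ 2 = ‖G‖ := by field_simp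
    conv_rhs => rw [← this, norm_sq_params G, mul_add, Finset.mul_sum]
    rw [e4]
    congr 1
    refine Finset.sum_congr rfl fun k _ => ?_
    simp only [e1, e2, e3, mul_add, Finset.mul_sum, ← hG]
    congr 1
    · congr 1
      · exact Finset.sum_congr rfl fun j _ => by ring
      · ring
    · ring
  have hcs : ‖G‖ ^ 2 ≤ (n : ℝ)⁻¹ * ∑ i, pC (a i) (x i) θ u ^ 2 := by
    rw [← hmean, mul_pow]
    have := sq_sum_le_card_mul_sum_sq (s := Finset.univ) (f := fun i => pC (a i) (x i) θ u)
    rw [Finset.card_univ, Fintype.card_fin] at this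
    calc _ ≤ (n : ℝ)⁻¹ ^ 2 * (n * ∑ i, pC (a i) (x i) θ u ^ 2) := by gcongr
      _ = _ := by field_simp
  set r : Fin n → ℝ := fun i => y i - frozenNet (a i) (x i) θ with hr
  have hL : 2 * empLoss n x y θ = (n : ℝ)⁻¹ * ∑ i, r i ^ 2 := by
    simp only [empLoss, hr, netFun_eq, ha]
    field_simp
  have hr1 : (n : ℝ)⁻¹ * ∑ i, |r i| ≤ √(2 * empLoss n x y θ) := by
    apply Real.le_sqrt_of_sq_le
    rw [hL, mul_pow]
    have := sq_sum_le_card_mul_sum_sq (s := Finset.univ) (f := fun i => |r i|)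
    simp only [Finset.card_univ, Fintype.card_fin, sq_abs] at this
    calc _ ≤ (n : ℝ)⁻¹ ^ 2 * (n * ∑ i, r i ^ 2) := by gcongr
      _ = _ := by field_simp
  have hq : ∑ i, 2 * r i * qC (a i) (x i) u ≤ (R + 1) * ∑ i, |r i| := by
    rw [Finset.mul_sum]
    refine Finset.sum_le_sum fun i _ => ?_
    have h1 := qC_le (a i) (fun k => by simp only [ha, act]; split_ifs <;> simp) (x i) u R hR
      (hx i) hu1
    calc 2 * r i * qC (a i) (x i) u ≤ |2 * r i * qC (a i) (x i) u| := le_abs_self _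
      _ = (2 * |qC (a i) (x i) u|) * |r i| := by rw [abs_mul, abs_mul, abs_two]; ring
      _ ≤ _ := by gcongr
  have hq2 : (n : ℝ)⁻¹ * ∑ i, 2 * r i * qC (a i) (x i) u ≤ (R + 1) * √(2 * empLoss n x y θ) := by
    calc _ ≤ (n : ℝ)⁻¹ * ((R + 1) * ∑ i, |r i|) := by gcongr
      _ = (R + 1) * ((n : ℝ)⁻¹ * ∑ i, |r i|) := by ring
      _ ≤ _ := by gcongr
  rw [Finset.sum_sub_distrib, mul_sub, one_div]
  have : 1 + 2 * ∑ k, cW n x θ k ≤ ‖G‖ ^ 2 := hG1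
  linarith


lemma gTilde_hom {d K n : ℕ} (hn : 0 < n) (x : Fin n → Euc d) (θ : Params d K) (k : Fin K)
    (W : Euc d) (hW : W = WithLp.toLp 2 (wP θ k)) (hW0 : 0 < ‖W‖) :
    |vP θ k * ‖W‖| * gTilde n x (‖W‖⁻¹ • W) (‖W‖⁻¹ * bP θ k) = cW n x θ k := by
  have hn' : (0 : ℝ) < n := by positivity
  have hdot : ∀ i, (∑ j, (‖W‖⁻¹ • W) j * x i j) - ‖W‖⁻¹ * bP θ k = ‖W‖⁻¹ * preA (x i) θ k := by
    intro i
    simp only [preA, mul_sub, Finset.mul_sum, PiLp.smul_apply, smul_eq_mul, mul_assoc]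
    rw [hW]
  have hfil : (Finset.univ.filter fun i => ‖W‖⁻¹ * bP θ k < ∑ j, (‖W‖⁻¹ • W) j * x i j) =
      Finset.univ.filter fun i => 0 < preA (x i) θ k := by
    ext i
    simp only [Finset.mem_filter, Finset.mem_univ, true_and]
    rw [← sub_pos, hdot i, mul_pos_iff_of_pos_left (by positivity)]
  unfold gTilde
  simp only [hfil, hdot]
  set A := Finset.univ.filter fun i => 0 < preA (x i) θ k with hA
  have e1 : ∑ i, act (x i) θ k * preA (x i) θ k = ∑ i ∈ A, preA (x i) θ k := by
    rw [hA, Finset.sum_filter]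
    refine Finset.sum_congr rfl fun i _ => ?_
    unfold act; split_ifs <;> simp
  have e2 : ∑ i, act (x i) θ k = (A.card : ℝ) := by
    rw [hA, Finset.card_filter]
    push_cast
    refine Finset.sum_congr rfl fun i _ => ?_
    unfold act; split_ifs <;> simp
  have e3 : ∑ i, act (x i) θ k • x i = ∑ i ∈ A, x i := by
    rw [hA, Finset.sum_filter]
    refine Finset.sum_congr rfl fun i _ => ?_
    unfold act; split_ifs <;> simp
  rw [cW, e1, e2, e3, ← Finset.mul_sum]
  rcases Finset.eq_empty_or_nonempty A with h | h
  · simp [h]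
  have hm : (0 : ℝ) < A.card := by exact_mod_cast h.card_pos
  set m : ℝ := (A.card : ℝ)
  set S := ∑ i ∈ A, preA (x i) θ k
  set X := ∑ i ∈ A, x i
  rw [norm_smul, norm_smul, norm_inv, norm_inv, Real.norm_of_nonneg hm.le,
    Real.norm_of_nonneg hn'.le, abs_mul, abs_of_pos hW0]
  have : ((n:ℝ)⁻¹ * m) ^ 2 + ((n:ℝ)⁻¹ * ‖X‖) ^ 2 = (m / n) ^ 2 * (1 + (m⁻¹ * ‖X‖) ^ 2) := by
    field_simp
  rw [this, Real.sqrt_mul (by positivity), Real.sqrt_sq (by positivity)]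
  field_simp

lemma cW_nonneg {d K n : ℕ} (x : Fin n → Euc d) (θ : Params d K) (k : Fin K) : 0 ≤ cW n x θ k := by
  unfold cW
  have : 0 ≤ ∑ i, act (x i) θ k * preA (x i) θ k := by
    refine Finset.sum_nonneg fun i _ => ?_
    rw [← relu_act]; exact le_max_right _ _
  positivity

lemma neuron_affine {d K : ℕ} (R : ℝ) (θ : Params d K) (k : Fin K)
    (h : ¬ (0 < ‖(WithLp.toLp 2 (wP θ k) : Euc d)‖ ∧
      |bP θ k| ≤ R * ‖(WithLp.toLp 2 (wP θ k) : Euc d)‖)) :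
    ∃ (c : Fin d → ℝ) (c₀ : ℝ), ∀ z : Euc d, ‖z‖ ≤ R →
      vP θ k * relu (preA z θ k) = (∑ j, c j * z j) + c₀ := by
  set N := ‖(WithLp.toLp 2 (wP θ k) : Euc d)‖ with hN
  have key : (∀ z : Euc d, ‖z‖ ≤ R → preA z θ k ≤ 0) ∨ (∀ z : Euc d, ‖z‖ ≤ R → 0 ≤ preA z θ k) := by
    by_cases hb : 0 ≤ bP θ k
    · left
      intro z hz
      have h1 := abs_dot_le (wP θ k) z R hz
      have h2 := (le_abs_self _).trans h1
      rw [abs_of_nonneg hb] at h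
      unfold preA
      by_contra h3
      apply h
      refine ⟨?_, by linarith⟩
      by_contra h4
      have : N = 0 := le_antisymm (not_lt.1 h4) (norm_nonneg _)
      rw [← hN, this] at h2
      simp at h2
      linarith
    · right
      intro z hz
      have h1 := abs_dot_le (wP θ k) z R hz
      have h2 := (neg_le_abs _).trans h1
      rw [abs_of_neg (not_le.1 hb)] at h
      unfold preA
      by_contra h3
      apply h
      refine ⟨?_, by linarith⟩
      by_contra h4
      have : N = 0 := le_antisymm (not_lt.1 h4) (norm_nonneg _)
      rw [← hN, this] at h2
      simp at h2
      linarith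
  rcases key with h | h
  · refine ⟨0, 0, fun z hz => ?_⟩
    simp [relu, h z hz]
  · refine ⟨fun j => vP θ k * wP θ k j, - vP θ k * bP θ k, fun z hz => ?_⟩
    rw [relu, max_eq_left (h z hz), preA, mul_sub, Finset.mul_sum]
    simp only [mul_assoc]
    ring

lemma Vg_le {d K n : ℕ} (R : ℝ) (hn : 0 < n) (x : Fin n → Euc d) (θ : Params d K) :
    VgSeminorm d R (gData n x) (fun z => netFun θ z) ≤ ENNReal.ofReal (∑ k, cW n x θ k) := by
  let W : Fin K → Euc d := fun k => WithLp.toLp 2 (wP θ k)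
  let S : Finset (Fin K) := Finset.univ.filter fun k => 0 < ‖W k‖ ∧ |bP θ k| ≤ R * ‖W k‖
  let p : Fin K → Euc d × ℝ := fun k => (‖W k‖⁻¹ • W k, ‖W k‖⁻¹ * bP θ k)
  let a : Fin K → ℝ := fun k => vP θ k * ‖W k‖
  have hS : ∀ k, k ∈ S ↔ (0 < ‖W k‖ ∧ |bP θ k| ≤ R * ‖W k‖) := fun k => by simp [S]
  obtain ⟨ν, h1, h2, h3⟩ := atomic_signed S a p
  have haff : ∀ k, ∃ (c : Fin d → ℝ) (c₀ : ℝ), k ∉ S → ∀ z : Euc d, ‖z‖ ≤ R →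
      vP θ k * relu (preA z θ k) = (∑ j, c j * z j) + c₀ := by
    intro k
    by_cases hk : k ∈ S
    · exact ⟨0, 0, fun h => absurd hk h⟩
    · obtain ⟨c, c₀, h⟩ := neuron_affine R θ k (fun h => hk ((hS k).2 h))
      exact ⟨c, c₀, fun _ => h⟩
  choose c c₀ hc using haff
  have hle : (∫⁻ q, ENNReal.ofReal (gData n x q) ∂ν.totalVariation) ≤
      ENNReal.ofReal (∑ k, cW n x θ k) := by
    refine (h3 (gData n x)).trans ?_
    rw [ENNReal.ofReal_sum_of_nonneg (fun k _ => cW_nonneg x θ k)]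
    refine (Finset.sum_le_sum (g := fun k => ENNReal.ofReal (cW n x θ k)) fun k hk => ?_).trans
      (Finset.sum_le_sum_of_subset (Finset.subset_univ S))
    apply ENNReal.ofReal_le_ofReal
    rw [← gTilde_hom hn x θ k (W k) rfl ((hS k).1 hk).1]
    exact mul_le_mul_of_nonneg_left (min_le_left _ _) (abs_nonneg _)
  refine le_trans (sInf_le ?_) hle
  refine ⟨ν, WithLp.toLp 2 (fun j => ∑ k ∈ Sᶜ, c k j), (∑ k ∈ Sᶜ, c₀ k) + betaP θ, ?_, ?_, rfl⟩
  · refine h1 _ (Metric.isClosed_sphere.measurableSet.prod measurableSet_Icc) ?_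
    intro k hk
    obtain ⟨hk1, hk2⟩ := (hS k).1 hk
    refine ⟨?_, ?_⟩
    · simp only [p, mem_sphere_zero_iff_norm]
      rw [norm_smul, norm_inv, norm_norm, inv_mul_cancel₀ hk1.ne']
    · simp only [p, Set.mem_Icc]
      rw [← abs_le, abs_mul, abs_of_pos (by positivity), inv_mul_le_iff₀ hk1, mul_comm]
      exact hk2
  · intro z hz
    have hz' : ‖z‖ ≤ R := by simpa using hz
    rw [h2 (fun q : Euc d × ℝ => relu ((∑ j, q.1 j * z j) - q.2))]
    have e1 : ∀ k ∈ S, a k * relu ((∑ j, (p k).1 j * z j) - (p k).2) =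
        vP θ k * relu (preA z θ k) := by
      intro k hk
      obtain ⟨hk1, hk2⟩ := (hS k).1 hk
      have : (∑ j, (p k).1 j * z j) - (p k).2 = ‖W k‖⁻¹ * preA z θ k := by
        simp only [p, preA, mul_sub, Finset.mul_sum, PiLp.smul_apply, smul_eq_mul, mul_assoc, W]
      rw [this, relu, relu]
      have h4 : max (‖W k‖⁻¹ * preA z θ k) 0 = ‖W k‖⁻¹ * max (preA z θ k) 0 := by
        rw [mul_max_of_nonneg _ _ (by positivity), mul_zero]
      rw [h4]
      simp only [a]
      field_simp
    rw [Finset.sum_congr rfl e1]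
    have e2 : netFun θ z = (∑ k, vP θ k * relu (preA z θ k)) + betaP θ := rfl
    beta_reduce
    rw [e2, ← Finset.sum_add_sum_compl S,
      Finset.sum_congr rfl (fun k hk => hc k (Finset.mem_compl.1 hk) z hz'),
      Finset.sum_add_distrib]
    simp only [Finset.sum_mul]
    rw [Finset.sum_comm]
    ring

/-- **Flat minima have small weighted variation norm (Theorem `thm:regularity`).** -/
theorem stable_minima_regularity
    (d K n : ℕ) (R : ℝ) (hR : 0 < R) (hn : 0 < n)
    (x : Fin n → Euc d) (y : Fin n → ℝ)
    (hx : ∀ i, x i ∈ Metric.closedBall (0 : Euc d) R)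
    (θ : Params d K) (hdiff : ContDiffAt ℝ 2 (empLoss n x y) θ) :
    VgSeminorm d R (gData n x) (fun z => netFun θ z) ≤
      ENNReal.ofReal (lambdaMax (empLoss n x y) θ / 2 - 1 / 2 +
        (R + 1) * Real.sqrt (2 * empLoss n x y θ)) := by
  have hx0 : ∀ i, ‖x i‖ ≤ R := fun i => by simpa using hx i
  have h := hess_main R hR hn x y hx0 θ hdiff
  refine (Vg_le R hn x θ).trans (ENNReal.ofReal_le_ofReal ?_)
  have h0 : 0 ≤ (R + 1) * Real.sqrt (2 * empLoss n x y θ) := by positivity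
  linarith

end
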